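/- Let H be a group DAG on a grouping W of a finite node set N in which some group has size at least 3. Then there exists a distribution p on N (with binary state spaces) such that p implies the same groupwise conditional independencies as H given W (i.e., p is groupwise faithful to H given W) and p is not faithful to any DAG on N. -/

import Mathlib

open scoped Classical

namespace GroupBN

variable {V : Type*} {I : Type*}

/-- `u` and `v` are adjacent in the digraph with arc relation `A`. -/
def Adj (A : V → V → Prop) (u v : V) : Prop := A u v ∨ A v u

/-- `A` is the arc relation of a DAG: there are no directed cycles
(in particular `A` is irreflexive). -/
def IsDAG (A : V → V → Prop) : Prop := ∀ v : V, ¬ Relation.TransGen A v v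

/-- `u` is an ancestor of `v`: there is a nonempty directed path from `u` to `v`. -/
def Ancestor (A : V → V → Prop) (u v : V) : Prop := Relation.TransGen A u v

/-- `u` and `v` are d-connected given `Z`: there is a path (an injective sequence of
pairwise adjacent consecutive nodes) from `u` to `v` such that every head-to-head
interior node is in `Z` or has a descendant in `Z`, and no other interior node is
in `Z`. -/
def DConn (A : V → V → Prop) (Z : Set V) (u v : V) : Prop :=
  ∃ (n : ℕ) (pth : Fin (n + 2) → V),
    Function.Injective pth ∧
    pth 0 = u ∧ pth (Fin.last (n + 1)) = v ∧
    (∀ (k : ℕ) (h : k + 1 < n + 2),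
      Adj A (pth ⟨k, Nat.lt_of_succ_lt h⟩) (pth ⟨k + 1, h⟩)) ∧
    (∀ (k : ℕ) (h : k + 2 < n + 2),
      (A (pth ⟨k, by omega⟩) (pth ⟨k + 1, by omega⟩) ∧
         A (pth ⟨k + 2, h⟩) (pth ⟨k + 1, by omega⟩) →
        (pth ⟨k + 1, by omega⟩ ∈ Z ∨ ∃ d ∈ Z, Ancestor A (pth ⟨k + 1, by omega⟩) d)) ∧
      (¬ (A (pth ⟨k, by omega⟩) (pth ⟨k + 1, by omega⟩) ∧
            A (pth ⟨k + 2, h⟩) (pth ⟨k + 1, by omega⟩)) →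
        pth ⟨k + 1, by omega⟩ ∉ Z))

/-- `u` and `v` are d-separated by `Z`. -/
def DSep (A : V → V → Prop) (Z : Set V) (u v : V) : Prop := ¬ DConn A Z u v

/-- The node sets `X` and `Y` are d-separated by `Z`. -/
def DSepSet (A : V → V → Prop) (Z X Y : Set V) : Prop :=
  ∀ x ∈ X, ∀ y ∈ Y, DSep A Z x y

variable {S : V → Type*}

/-- `p` is a probability mass function on the joint state space. -/
def IsDist [Fintype V] [DecidableEq V] [∀ v, Fintype (S v)]
    (p : (∀ v, S v) → ℝ) : Prop :=
  (∀ f, 0 ≤ p f) ∧ ∑ f, p f = 1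

/-- Marginal probability, under `p`, of the event that the variables in `X` take
the values prescribed by the assignment `a`. -/
noncomputable def margin [Fintype V] [DecidableEq V] [∀ v, Fintype (S v)]
    (p : (∀ v, S v) → ℝ) (X : Set V) (a : ∀ v, S v) : ℝ :=
  ∑ f : ∀ v, S v, if ∀ v ∈ X, f v = a v then p f else 0

/-- Conditional independence `X ⊥ Y | Z` in `p`, in cross-multiplied form:
for every assignment whose `Z`-part has positive probability,
`P(X,Y,Z) · P(Z) = P(X,Z) · P(Y,Z)`. -/
def CondIndep [Fintype V] [DecidableEq V] [∀ v, Fintype (S v)]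
    (p : (∀ v, S v) → ℝ) (X Y Z : Set V) : Prop :=
  ∀ a : ∀ v, S v, 0 < margin p Z a →
    margin p (X ∪ Y ∪ Z) a * margin p Z a = margin p (X ∪ Z) a * margin p (Y ∪ Z) a

/-- `p` is faithful to the DAG `A`: conditional independence coincides with
d-separation for all pairwise disjoint `X`, `Y`, `Z` with `X`, `Y` nonempty. -/
def Faithful [Fintype V] [DecidableEq V] [∀ v, Fintype (S v)]
    (p : (∀ v, S v) → ℝ) (A : V → V → Prop) : Prop :=
  ∀ X Y Z : Set V, X.Nonempty → Y.Nonempty →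
    Disjoint X Y → Disjoint X Z → Disjoint Y Z →
    (CondIndep p X Y Z ↔ DSepSet A Z X Y)

/-- `p` is groupwise faithful to the group DAG `H` given the grouping whose groups
are the fibers of the surjection `π`. -/
def GroupwiseFaithful [Fintype V] [DecidableEq V] [∀ v, Fintype (S v)]
    (p : (∀ v, S v) → ℝ) (π : V → I) (H : I → I → Prop) : Prop :=
  ∀ i j : I, i ≠ j → ∀ T : Set I, i ∉ T → j ∉ T →
    (CondIndep p (π ⁻¹' {i}) (π ⁻¹' {j}) (π ⁻¹' T) ↔ DSep H T i j)

/-- The variable DAG `A` is groupwise Markov equivalent to the group DAG `H`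
given the grouping whose groups are the fibers of the surjection `π`. -/
def GroupwiseMarkovEquiv (A : V → V → Prop) (π : V → I) (H : I → I → Prop) : Prop :=
  ∀ i j : I, i ≠ j → ∀ T : Set I, i ∉ T → j ∉ T →
    (DSepSet A (π ⁻¹' T) (π ⁻¹' {i}) (π ⁻¹' {j}) ↔ DSep H T i j)

section Walks

variable {A : V → V → Prop} {T : Set V}

/-- The triple `x, y, z` of consecutive nodes does not block a walk given `T`. -/
def Passes (A : V → V → Prop) (T : Set V) (x y z : V) : Prop :=
  (A x y ∧ A z y → y ∈ T ∨ ∃ d ∈ T, Ancestor A y d) ∧ (¬ (A x y ∧ A z y) → y ∉ T)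

/-- `w 0, …, w n` is a walk (repetitions allowed) that is active given `T`. -/
def ActiveWalk (A : V → V → Prop) (T : Set V) (n : ℕ) (w : ℕ → V) : Prop :=
  (∀ k < n, Adj A (w k) (w (k + 1))) ∧
    ∀ k, k + 2 ≤ n → Passes A T (w k) (w (k + 1)) (w (k + 2))

/-- `u` and `v` are the ends of a walk that is active given `T`. -/
def ActiveConn (A : V → V → Prop) (T : Set V) (u v : V) : Prop :=
  ∃ n w, ActiveWalk A T n w ∧ w 0 = u ∧ w n = v

theorem IsDAG.asymm (hA : IsDAG A) {u v : V} (h : A u v) : ¬ A v u := fun h' =>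
  hA u ((Relation.TransGen.single h).tail h')

theorem ActiveWalk.extend {n : ℕ} {w : ℕ → V} (hw : ActiveWalk A T n w) {x : V}
    (hx : Adj A (w n) x) (hp : ∀ k, n = k + 1 → Passes A T (w k) (w n) x) :
    ∃ w', ActiveWalk A T (n + 1) w' ∧ (∀ k ≤ n, w' k = w k) ∧ w' (n + 1) = x := by
  refine ⟨fun k => if k ≤ n then w k else x, ⟨fun k hk => ?_, fun k hk => ?_⟩, ?_, ?_⟩
  · rcases Nat.lt_succ_iff_lt_or_eq.1 hk with h | rfl
    · simpa [h.le, Nat.succ_le_of_lt h] using hw.1 k h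
    · simpa using hx
  · rcases Nat.lt_or_ge n (k + 2) with h | h
    · obtain rfl : n = k + 1 := by omega
      simpa using hp k rfl
    · simpa [h, show k ≤ n by omega, show k + 1 ≤ n by omega] using hw.2 k h
  · intro k hk; simp [hk]
  · simp

theorem ActiveConn.refl (u : V) : ActiveConn A T u u :=
  ⟨0, fun _ => u, ⟨by simp, by simp⟩, rfl, rfl⟩

theorem ActiveConn.forward (hA : IsDAG A) {i u x : V} (h : ActiveConn A T i u) (hu : u ∉ T)
    (hx : A u x) : ActiveConn A T i x := by
  obtain ⟨n, w, hw, rfl, rfl⟩ := h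
  obtain ⟨w', h1, h2, h3⟩ := hw.extend (x := x) (Or.inl hx)
    fun k hk => ⟨fun hc => (hA.asymm hx hc.2).elim, fun _ => hu⟩
  exact ⟨n + 1, w', h1, h2 0 (Nat.zero_le _), h3⟩

theorem ActiveConn.adj {i u x : V} (h : ActiveConn A T i u) (hu : u ∉ T)
    (hd : ∃ d ∈ T, Ancestor A u d) (hx : Adj A u x) : ActiveConn A T i x := by
  obtain ⟨n, w, hw, rfl, rfl⟩ := h
  obtain ⟨w', h1, h2, h3⟩ := hw.extend (x := x) hx fun k hk => ⟨fun _ => Or.inr hd, fun _ => hu⟩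
  exact ⟨n + 1, w', h1, h2 0 (Nat.zero_le _), h3⟩

theorem ActiveConn.coparent (hA : IsDAG A) {i u c x : V} (h : ActiveConn A T i u) (hu : u ∉ T)
    (huc : A u c) (hxc : A x c) (hc : c ∈ T ∨ ∃ d ∈ T, Ancestor A c d) :
    ActiveConn A T i x := by
  obtain ⟨n, w, hw, rfl, rfl⟩ := h
  obtain ⟨w', h1, h2, h3⟩ := hw.extend (x := c) (Or.inl huc)
    fun k hk => ⟨fun hc => (hA.asymm huc hc.2).elim, fun _ => hu⟩
  subst h3
  obtain ⟨w'', h1', h2', h3'⟩ := h1.extend (x := x) (Or.inr hxc) (by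
    intro k hk
    obtain rfl : n = k := by omega
    rw [h2 n le_rfl]
    exact ⟨fun _ => hc, fun h => (h ⟨huc, hxc⟩).elim⟩)
  exact ⟨n + 2, w'', h1', by rw [h2' 0 (by omega), h2 0 (by omega)], h3'⟩

theorem activeConn_of_ancestor (hA : IsDAG A) {i u x : V} (hu : Relation.ReflTransGen A u i)
    (hT : u ∉ T) (hT' : ¬ ∃ d ∈ T, Ancestor A u d) (hx : A x u) : ActiveConn A T i x := by
  have key : ∃ n w, ActiveWalk A T n w ∧ w 0 = i ∧ w n = u ∧ ∀ k, n = k + 1 → A u (w k) := by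
    clear hx
    induction hu using Relation.ReflTransGen.head_induction_on with
    | refl => exact ⟨0, fun _ => i, ⟨by simp, by simp⟩, rfl, rfl, by simp⟩
    | @head a c hac hci ih =>
      have hc : c ∉ T := fun hc => hT' ⟨c, hc, Relation.TransGen.single hac⟩
      obtain ⟨n, w, hw, h0, rfl, hlast⟩ := ih hc
        (fun ⟨d, hd, h⟩ => hT' ⟨d, hd, Relation.TransGen.head hac h⟩)
      obtain ⟨w', h1, h2, h3⟩ := hw.extend (x := a) (Or.inr hac)
        fun k hk => ⟨fun hcol => (hA.asymm (hlast k hk) hcol.1).elim, fun _ => hc⟩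
      refine ⟨n + 1, w', h1, by rw [h2 0 (by omega), h0], h3, fun k hk => ?_⟩
      obtain rfl : n = k := by omega
      rwa [h2 n le_rfl]
  obtain ⟨n, w, hw, rfl, rfl, hlast⟩ := key
  obtain ⟨w', h1, h2, h3⟩ := hw.extend (x := x) (Or.inr hx)
    fun k hk => ⟨fun hcol => (hA.asymm (hlast k hk) hcol.1).elim, fun _ => hT⟩
  exact ⟨n + 1, w', h1, h2 0 (by omega), h3⟩

theorem ActiveConn.descend (hA : IsDAG A) {i u j : V} (h : ActiveConn A T i u) (hu : u ∉ T)
    (hu' : ¬ ∃ d ∈ T, Ancestor A u d) (huj : Relation.ReflTransGen A u j) :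
    ActiveConn A T i j := by
  induction huj with
  | refl => exact h
  | @tail b c hab hbc ih =>
    refine ih.forward hA (fun hb => ?_) hbc
    rcases Relation.reflTransGen_iff_eq_or_transGen.1 hab with rfl | hab
    · exact hu hb
    · exact hu' ⟨b, hb, hab⟩

/-- The nodes that are `i`, `j`, in `T`, or ancestors of such nodes. -/
def ancClosure (A : V → V → Prop) (T : Set V) (i j : V) : Set V :=
  {v | ∃ x, (x = i ∨ x = j ∨ x ∈ T) ∧ Relation.ReflTransGen A v x}

theorem ancClosure_parent {i j u v : V} (hv : v ∈ ancClosure A T i j) (h : A u v) :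
    u ∈ ancClosure A T i j := by
  obtain ⟨x, hx, hvx⟩ := hv
  exact ⟨x, hx, hvx.head h⟩

theorem ActiveConn.parent (hA : IsDAG A) {i j u x : V} (hij : ¬ ActiveConn A T i j)
    (h : ActiveConn A T i u) (hu : u ∉ T) (hcl : u ∈ ancClosure A T i j) (hx : A x u) :
    ActiveConn A T i x := by
  by_cases hd : ∃ d ∈ T, Ancestor A u d
  · exact h.adj hu hd (Or.inr hx)
  · obtain ⟨y, rfl | rfl | hy, huy⟩ := hcl
    · exact activeConn_of_ancestor hA huy hu hd hx
    · exact (hij (h.descend hA hu hd huy)).elim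
    · rcases Relation.reflTransGen_iff_eq_or_transGen.1 huy with rfl | huy
      · exact (hu hy).elim
      · exact (hd ⟨y, hy, huy⟩).elim

theorem ActiveConn.coparent' (hA : IsDAG A) {i j u c x : V} (hij : ¬ ActiveConn A T i j)
    (h : ActiveConn A T i u) (hu : u ∉ T) (hcl : c ∈ ancClosure A T i j)
    (huc : A u c) (hxc : A x c) : ActiveConn A T i x := by
  by_cases hc : c ∈ T ∨ ∃ d ∈ T, Ancestor A c d
  · exact h.coparent hA hu huc hxc hc
  · exact (h.forward hA hu huc).parent hA hij (fun h' => hc (Or.inl h')) hcl hxc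

/-- A stretch of an active walk that leaves `w k` along an arc either consists of arcs pointing
away from `w k`, or meets a collider below `w k`. -/
theorem ActiveWalk.forward_or {n : ℕ} {w : ℕ → V} (hw : ActiveWalk A T n w) {k : ℕ}
    (hk : A (w k) (w (k + 1))) (m : ℕ) (hm : k + m + 1 ≤ n) :
    (A (w (k + m)) (w (k + m + 1)) ∧ Ancestor A (w k) (w (k + m + 1))) ∨
      ∃ d ∈ T, Ancestor A (w k) d := by
  induction m with
  | zero => exact Or.inl ⟨hk, Relation.TransGen.single hk⟩
  | succ m ih =>
    rcases ih (by omega) with ⟨h1, h2⟩ | h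
    · rcases hw.1 (k + m + 1) (by omega) with h | h
      · exact Or.inl ⟨h, Relation.TransGen.tail h2 h⟩
      · rcases (hw.2 (k + m) (by omega)).1 ⟨h1, h⟩ with h' | ⟨d, hd, h'⟩
        · exact Or.inr ⟨_, h', h2⟩
        · exact Or.inr ⟨d, hd, Relation.TransGen.trans h2 h'⟩
    · exact Or.inr h

/-- A closed stretch can be cut out of an active walk. -/
theorem ActiveWalk.cut {n : ℕ} {w : ℕ → V} (hw : ActiveWalk A T n w)
    {k d : ℕ} (hd : 0 < d) (hkd : k + d ≤ n) (h : w k = w (k + d)) :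
    ActiveWalk A T (n - d) (fun m => if m ≤ k then w m else w (m + d)) := by
  have hval : ∀ m, k ≤ m → (if m ≤ k then w m else w (m + d)) = w (m + d) := by
    intro m hm
    split_ifs with h'
    · obtain rfl : m = k := by omega
      exact h
    · rfl
  have hval' : ∀ m, m ≤ k → (if m ≤ k then w m else w (m + d)) = w m := fun m hm => if_pos hm
  refine ⟨fun m hm => ?_, fun m hm => ?_⟩
  · rcases Nat.lt_or_ge m k with h' | h'
    · simp only [hval' m h'.le, hval' (m + 1) h']
      exact hw.1 m (by omega)
    · simp only [hval m h', hval (m + 1) (by omega)]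
      rw [show m + 1 + d = m + d + 1 by omega]
      exact hw.1 _ (by omega)
  · rcases Nat.lt_or_ge k (m + 1) with h' | h'
    · simp only [hval m (by omega), hval (m + 1) (by omega), hval (m + 2) (by omega)]
      rw [show m + 1 + d = m + d + 1 by omega, show m + 2 + d = m + d + 2 by omega]
      exact hw.2 _ (by omega)
    rcases Nat.lt_or_ge (m + 1) k with h'' | h''
    · simp only [hval' m (by omega), hval' (m + 1) (by omega), hval' (m + 2) (by omega)]
      exact hw.2 _ (by omega)
    · obtain rfl : k = m + 1 := by omega
      simp only [hval' m (by omega), hval' (m + 1) (by omega), hval (m + 2) (by omega)]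
      have p1 := hw.2 m (by omega)
      have p2 := hw.2 (m + d) (by omega)
      rw [show m + d + 1 = m + 1 + d by omega, ← h, show m + d + 2 = m + 2 + d by omega] at p2
      refine ⟨fun ⟨ha, hb⟩ => ?_, fun hnc hT => ?_⟩
      · by_cases hc1 : A (w (m + 2)) (w (m + 1))
        · exact p1.1 ⟨ha, hc1⟩
        by_cases hc2 : A (w (m + d)) (w (m + 1))
        · exact p2.1 ⟨hc2, hb⟩
        have e1 : A (w (m + 1)) (w (m + 2)) := (hw.1 (m + 1) (by omega)).resolve_right hc1
        have e2 : A (w (m + 1)) (w (m + d)) := by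
          have := hw.1 (m + d) (by omega)
          rw [show m + d + 1 = m + 1 + d by omega, ← h] at this
          exact this.resolve_left hc2
        rcases hw.forward_or (k := m + 1) e1 (d - 1) (by omega) with ⟨h3, -⟩ | h3
        · rw [show m + 1 + (d - 1) = m + d by omega, show m + d + 1 = m + 1 + d by omega,
            ← h] at h3
          exact (hc2 h3).elim
        · exact Or.inr h3
      · have q1 := not_not.1 fun h => p1.2 h hT
        have q2 := not_not.1 fun h => p2.2 h hT
        exact hnc ⟨q1.1, q2.2⟩

theorem ActiveConn.dConn {i j : V} (hij : i ≠ j) (h : ActiveConn A T i j) :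
    DConn A T i j := by
  classical
  have hn := Nat.find_spec h
  have hmin := fun m => Nat.find_min h (m := m)
  generalize Nat.find h = n at hn hmin
  obtain ⟨w, hw, h0, hn⟩ := hn
  obtain ⟨n, rfl⟩ : ∃ m, n = m + 1 := by
    cases n with
    | zero => exact (hij (h0.symm.trans hn)).elim
    | succ m => exact ⟨m, rfl⟩
  have hlt : ∀ a b, a < b → b ≤ n + 1 → w a ≠ w b := by
    intro a b hab hb heq
    obtain ⟨d, rfl⟩ := Nat.exists_eq_add_of_le hab.le
    refine hmin (n + 1 - d) (by omega) ⟨_, hw.cut (by omega) hb heq, ?_, ?_⟩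
    · simpa using h0
    · split_ifs with h'
      · obtain h'' : n + 1 - d = a := by omega
        rw [h'', heq, show a + d = n + 1 by omega, hn]
      · rw [show n + 1 - d + d = n + 1 by omega, hn]
  refine ⟨n, fun k => w k, ?_, h0, hn, fun k hk => hw.1 k (by omega),
    fun k hk => hw.2 k (by omega)⟩
  intro a b hab
  by_contra hne
  rcases lt_or_gt_of_ne hne with h' | h'
  · exact hlt a b h' (by omega) hab
  · exact hlt b a h' (by omega) hab.symm

end Walks

section Factorization

variable {A : V → V → Prop} {θ : V → (V → Bool) → ℝ}

/-- `θ v f` is a conditional probability of `v` being `true` given the values that `f` prescribes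
for the parents of `v`. -/
def IsKernel (A : V → V → Prop) (θ : V → (V → Bool) → ℝ) : Prop :=
  ∀ v f, 0 ≤ θ v f ∧ θ v f ≤ 1 ∧ ∀ g, (∀ u, A u v → f u = g u) → θ v f = θ v g

/-- The conditional probability of the value `f v` given the values of the parents of `v`. -/
def factor (θ : V → (V → Bool) → ℝ) (v : V) (f : V → Bool) : ℝ :=
  if f v then θ v f else 1 - θ v f

/-- The distribution with conditional probabilities `θ`. -/
def joint [Fintype V] (θ : V → (V → Bool) → ℝ) (f : V → Bool) : ℝ := ∏ v, factor θ v f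

theorem IsKernel.factor_nonneg (hθ : IsKernel A θ) (v : V) (f : V → Bool) :
    0 ≤ factor θ v f := by
  unfold factor
  have := hθ v f
  split_ifs <;> linarith

theorem IsKernel.factor_congr (hθ : IsKernel A θ) {v : V} {f g : V → Bool} (hv : f v = g v)
    (h : ∀ u, A u v → f u = g u) : factor θ v f = factor θ v g := by
  unfold factor
  rw [(hθ v f).2.2 g h, hv]

theorem IsKernel.joint_nonneg [Fintype V] (hθ : IsKernel A θ) (f : V → Bool) : 0 ≤ joint θ f :=
  Finset.prod_nonneg fun v _ => hθ.factor_nonneg v f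

variable [DecidableEq V]

/-- Negate the value of `f` at `s`. -/
def flip (s : V) : (V → Bool) ≃ (V → Bool) :=
  Function.Involutive.toPerm (fun f => Function.update f s (!f s)) fun f => by simp

theorem flip_self (s : V) (f : V → Bool) : flip s f s = !f s := by
  simp [flip, Function.Involutive.toPerm]

theorem flip_of_ne {s v : V} (h : v ≠ s) (f : V → Bool) : flip s f v = f v := by
  simp [flip, Function.Involutive.toPerm, h]

theorem IsKernel.factor_add_flip (hA : IsDAG A) (hθ : IsKernel A θ) (v : V) (f : V → Bool) :
    factor θ v f + factor θ v (flip v f) = 1 := by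
  have h : θ v (flip v f) = θ v f := by
    refine (hθ v _).2.2 f fun u hu => flip_of_ne ?_ f
    rintro rfl
    exact hA u (Relation.TransGen.single hu)
  unfold factor
  rw [h, flip_self]
  cases f v <;> simp

variable [Fintype V]

theorem margin_eq_sum (p : (V → Bool) → ℝ) (X : Set V) (a : V → Bool) :
    margin (S := fun _ : V => Bool) p X a = ∑ f : V → Bool, if ∀ v ∈ X, f v = a v then p f else 0 :=
  Finset.sum_congr rfl fun f _ => by congr

/-- A variable that is summed out together with its factor contributes `1 / 2` of the sum without
that factor. -/
theorem IsKernel.sum_mul_factor (hA : IsDAG A) (hθ : IsKernel A θ) (s : V)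
    (F : (V → Bool) → ℝ) (hF : ∀ f, F (flip s f) = F f) :
    ∑ f, F f * factor θ s f = 1 / 2 * ∑ f, F f := by
  have h1 : ∑ f, F f * factor θ s f = ∑ f, F f * factor θ s (flip s f) := by
    rw [← Equiv.sum_comp (flip s) fun f => F f * factor θ s f]
    simp only [hF]
  have h2 : ∑ f, F f * factor θ s f + ∑ f, F f * factor θ s (flip s f) = ∑ f, F f := by
    rw [← Finset.sum_add_distrib]
    refine Finset.sum_congr rfl fun f _ => ?_
    rw [← mul_add, hθ.factor_add_flip hA, mul_one]
  linarith

theorem IsKernel.sum_mul_prod_factor (hA : IsDAG A) (hθ : IsKernel A θ) (B : Finset V)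
    (φ : (V → Bool) → ℝ) (hφ : ∀ f g, (∀ v ∈ B, f v = g v) → φ f = φ g)
    (hB : ∀ u v, A u v → v ∈ B → u ∈ B) (C : Finset V)
    (hC : ∀ u v, A u v → v ∈ C → u ∈ C) (hBC : B ⊆ C) :
    ∑ f, φ f * ∏ v ∈ C, factor θ v f =
      (1 / 2) ^ (C \ B).card * ∑ f, φ f * ∏ v ∈ B, factor θ v f := by
  induction h : (C \ B).card generalizing C with
  | zero =>
    rw [Finset.card_eq_zero, Finset.sdiff_eq_empty_iff_subset] at h
    rw [hBC.antisymm h]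
    simp
  | succ n ih =>
    have hwf : WellFounded (fun u v => Ancestor A v u) := by
      have : IsTrans V (fun u v => Ancestor A v u) :=
        ⟨fun a b c h1 h2 => Relation.TransGen.trans h2 h1⟩
      have : Std.Irrefl (fun u v => Ancestor A v u) := ⟨fun a => hA a⟩
      exact Finite.wellFounded_of_trans_of_irrefl _
    obtain ⟨s, hs, hmax⟩ := hwf.has_min (C \ B : Finset V)
      (Finset.coe_nonempty.2 (Finset.card_pos.1 (by omega)))
    rw [Finset.mem_coe, Finset.mem_sdiff] at hs
    have hchild : ∀ v ∈ C, ¬ A s v := by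
      intro v hv hsv
      by_cases hvB : v ∈ B
      · exact hs.2 (hB s v hsv hvB)
      · exact hmax v (by simp [hv, hvB]) (Relation.TransGen.single hsv)
    have e1 : ∑ f, φ f * ∏ v ∈ C, factor θ v f =
        ∑ f, (φ f * ∏ v ∈ C.erase s, factor θ v f) * factor θ s f := by
      refine Finset.sum_congr rfl fun f _ => ?_
      rw [mul_assoc, Finset.prod_erase_mul _ _ hs.1]
    rw [e1, hθ.sum_mul_factor hA, ih (C.erase s), pow_succ']
    · ring
    · intro u v huv hv
      rw [Finset.mem_erase] at hv ⊢
      refine ⟨?_, hC u v huv hv.2⟩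
      rintro rfl
      exact hchild v hv.2 huv
    · intro v hv
      rw [Finset.mem_erase]
      refine ⟨?_, hBC hv⟩
      rintro rfl
      exact hs.2 hv
    · rw [Finset.erase_sdiff_comm, Finset.card_erase_of_mem (Finset.mem_sdiff.2 hs), h]
      rfl
    · intro f
      congr 1
      · refine hφ _ _ fun v hv => flip_of_ne ?_ f
        rintro rfl
        exact hs.2 hv
      · refine Finset.prod_congr rfl fun v hv => ?_
        rw [Finset.mem_erase] at hv
        refine hθ.factor_congr (flip_of_ne hv.1 f) fun u hu => flip_of_ne ?_ f
        rintro rfl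
        exact hchild v hv.2 hu

theorem IsKernel.isDist_joint (hA : IsDAG A) (hθ : IsKernel A θ) :
    IsDist (S := fun _ : V => Bool) (joint θ) := by
  refine ⟨hθ.joint_nonneg, ?_⟩
  have := hθ.sum_mul_prod_factor hA ∅ (fun _ => 1) (by simp) (by simp) Finset.univ (by simp)
    (by simp)
  simp only [one_mul] at this
  unfold joint
  rw [this]
  simp

theorem IsKernel.margin_joint (hA : IsDAG A) (hθ : IsKernel A θ) (B : Finset V)
    (hB : ∀ u v, A u v → v ∈ B → u ∈ B) (X : Set V) (hX : X ⊆ B) (a : V → Bool) :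
    margin (S := fun _ : V => Bool) (joint θ) X a =
      (1 / 2) ^ Bᶜ.card *
        ∑ f : V → Bool, if ∀ v ∈ X, f v = a v then ∏ v ∈ B, factor θ v f else 0 := by
  have := hθ.sum_mul_prod_factor hA B (fun f => if ∀ v ∈ X, f v = a v then 1 else 0)
    (by
      intro f g hfg
      have : (∀ v ∈ X, f v = a v) ↔ ∀ v ∈ X, g v = a v :=
        forall₂_congr fun v hv => by rw [hfg v (hX hv)]
      simp only [this])
    hB Finset.univ (by simp) (by simp)
  simp only [ite_mul, one_mul, zero_mul, ← Finset.compl_eq_univ_sdiff] at this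
  rw [← this, margin_eq_sum]
  rfl

/-- Exchange two assignments outside of `U`. -/
noncomputable def swapOff (U : Set V) : (V → Bool) × (V → Bool) ≃ (V → Bool) × (V → Bool) :=
  Function.Involutive.toPerm
    (fun p => (fun v => if v ∈ U then p.1 v else p.2 v, fun v => if v ∈ U then p.2 v else p.1 v))
    fun p => by
      ext v <;> by_cases h : v ∈ U <;> simp [h]

theorem IsKernel.condIndep_joint (hA : IsDAG A) (hθ : IsKernel A θ) {i j : V} (hij : i ≠ j)
    {T : Set V} (hi : i ∉ T) (hj : j ∉ T) (hsep : DSep A T i j) :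
    CondIndep (S := fun _ : V => Bool) (joint θ) {i} {j} T := by
  intro a _
  have hn : ¬ ActiveConn A T i j := fun h => hsep (h.dConn hij)
  set B : Finset V := Finset.univ.filter (· ∈ ancClosure A T i j) with hBdef
  have hmem : ∀ v, v ∈ B ↔ v ∈ ancClosure A T i j := by simp [hBdef]
  have hB : ∀ u v, A u v → v ∈ B → u ∈ B := fun u v huv hv =>
    (hmem u).2 (ancClosure_parent ((hmem v).1 hv) huv)
  have hTB : T ⊆ B := fun v hv => (hmem v).2 ⟨v, Or.inr (Or.inr hv), .refl⟩
  have hiB : {i} ⊆ (B : Set V) := Set.singleton_subset_iff.2 ((hmem i).2 ⟨i, Or.inl rfl, .refl⟩)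
  have hjB : {j} ⊆ (B : Set V) :=
    Set.singleton_subset_iff.2 ((hmem j).2 ⟨j, Or.inr (Or.inl rfl), .refl⟩)
  rw [hθ.margin_joint hA B hB _ (Set.union_subset (Set.union_subset hiB hjB) hTB),
    hθ.margin_joint hA B hB _ (Set.union_subset hiB hTB),
    hθ.margin_joint hA B hB _ (Set.union_subset hjB hTB), hθ.margin_joint hA B hB _ hTB,
    mul_mul_mul_comm]
  conv_rhs => rw [mul_mul_mul_comm]
  congr 1
  set U : Set V := {u | u ∉ T ∧ u ∈ B ∧ ActiveConn A T i u} with hU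
  have hiU : i ∈ U := ⟨hi, hiB rfl, .refl i⟩
  have hjU : j ∉ U := fun h => hn h.2.2
  have hfac : ∀ f f' : V → Bool, (∀ v ∈ T, f v = f' v) → ∀ v ∈ B,
      factor θ v f * factor θ v f' =
        factor θ v (swapOff U (f, f')).1 * factor θ v (swapOff U (f, f')).2 := by
    intro f f' hT v hv
    have keep : ∀ u, u ∈ U ∨ u ∈ T →
        f u = (swapOff U (f, f')).1 u ∧ f' u = (swapOff U (f, f')).2 u := by
      intro u hu
      by_cases h : u ∈ U
      · simp [swapOff, Function.Involutive.toPerm, h]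
      · simp [swapOff, Function.Involutive.toPerm, h, hT u (hu.resolve_left h)]
    have exch : ∀ u, u ∉ U →
        f u = (swapOff U (f, f')).2 u ∧ f' u = (swapOff U (f, f')).1 u := by
      intro u h
      simp [swapOff, Function.Involutive.toPerm, h]
    have hUT : ∀ u, u ∈ B → ActiveConn A T i u → u ∈ U ∨ u ∈ T := by
      intro u hu h
      by_cases hT : u ∈ T
      · exact Or.inr hT
      · exact Or.inl ⟨hT, hu, h⟩
    by_cases hc : v ∈ U ∨ ∃ u ∈ U, A u v
    · have hvk : v ∈ U ∨ v ∈ T := by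
        obtain h | ⟨u, hu, huv⟩ := hc
        · exact Or.inl h
        · exact hUT v hv (hu.2.2.forward hA hu.1 huv)
      have hpk : ∀ x, A x v → x ∈ U ∨ x ∈ T := by
        intro x hx
        refine hUT x (hB x v hx hv) ?_
        obtain h | ⟨u, hu, huv⟩ := hc
        · exact h.2.2.parent hA hn h.1 ((hmem v).1 hv) hx
        · exact hu.2.2.coparent' hA hn hu.1 ((hmem v).1 hv) huv hx
      rw [hθ.factor_congr (keep v hvk).1 fun x hx => (keep x (hpk x hx)).1,
        hθ.factor_congr (keep v hvk).2 fun x hx => (keep x (hpk x hx)).2]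
    · push Not at hc
      have hp : ∀ x, A x v → x ∉ U := fun x hx h => hc.2 x h hx
      rw [hθ.factor_congr (exch v hc.1).1 fun x hx => (exch x (hp x hx)).1,
        hθ.factor_congr (exch v hc.1).2 fun x hx => (exch x (hp x hx)).2, mul_comm]
  rw [Finset.sum_mul_sum, Finset.sum_mul_sum, ← Fintype.sum_prod_type',
    ← Fintype.sum_prod_type', ← Equiv.sum_comp (swapOff U)]
  refine Finset.sum_congr rfl fun p _ => ?_
  obtain ⟨f, f'⟩ := p
  have hin : ∀ u, u ∈ U → (swapOff U (f, f')).1 u = f u ∧ (swapOff U (f, f')).2 u = f' u := by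
    intro u h
    simp [swapOff, Function.Involutive.toPerm, h]
  have hout : ∀ u, u ∉ U → (swapOff U (f, f')).1 u = f' u ∧ (swapOff U (f, f')).2 u = f u := by
    intro u h
    simp [swapOff, Function.Involutive.toPerm, h]
  have hTT : ∀ u ∈ T, (swapOff U (f, f')).1 u = f' u ∧ (swapOff U (f, f')).2 u = f u :=
    fun u hu => hout u fun h => h.1 hu
  have hcond : ((∀ v ∈ ({i} ∪ {j} ∪ T : Set V), (swapOff U (f, f')).1 v = a v) ∧
      ∀ v ∈ T, (swapOff U (f, f')).2 v = a v) ↔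
      (∀ v ∈ ({i} ∪ T : Set V), f v = a v) ∧ ∀ v ∈ ({j} ∪ T : Set V), f' v = a v := by
    have e1 := (hin i hiU).1
    have e2 := (hout j hjU).1
    constructor
    · rintro ⟨h1, h2⟩
      refine ⟨?_, ?_⟩
      · rintro v (rfl | hv)
        · rw [← e1]; exact h1 _ (by simp)
        · rw [← (hTT v hv).2]; exact h2 v hv
      · rintro v (rfl | hv)
        · rw [← e2]; exact h1 _ (by simp)
        · rw [← (hTT v hv).1]; exact h1 v (by simp [hv])
    · rintro ⟨h1, h2⟩
      refine ⟨?_, fun v hv => ?_⟩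
      · rintro v ((rfl | rfl) | hv)
        · rw [e1]; exact h1 _ (by simp)
        · rw [e2]; exact h2 _ (by simp)
        · rw [(hTT v hv).1]; exact h2 v (by simp [hv])
      · rw [(hTT v hv).2]; exact h1 v (by simp [hv])
  rw [ite_zero_mul_ite_zero, ite_zero_mul_ite_zero]
  by_cases hc : (∀ v ∈ ({i} ∪ T : Set V), f v = a v) ∧ ∀ v ∈ ({j} ∪ T : Set V), f' v = a v
  · rw [if_pos (hcond.2 hc), if_pos hc, ← Finset.prod_mul_distrib, ← Finset.prod_mul_distrib]
    refine Finset.prod_congr rfl fun v hv => (hfac f f' (fun u hu => ?_) v hv).symm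
    rw [hc.1 u (Or.inr hu), hc.2 u (Or.inr hu)]
  · rw [if_neg (mt hcond.1 hc), if_neg hc]

end Factorization

section Chains

variable {A : V → V → Prop} {T : Set V} {i j : V}

/-- `v` is reached from `u` by a directed path none of whose nodes, except possibly `v`, is
in `T`. -/
def Reach (A : V → V → Prop) (T : Set V) (u v : V) : Prop :=
  Relation.ReflTransGen (fun x y => A x y ∧ x ∉ T) u v

/-- Nodes outside `T` that are linked to `i` by a sequence of nodes outside `T`, the first of
which reaches `i`, and any two consecutive ones of which reach a common node of `T`. -/
inductive Linked (A : V → V → Prop) (T : Set V) (i : V) : V → Prop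
  | start {u : V} : u ∉ T → Reach A T u i → Linked A T i u
  | link {u v t : V} : Linked A T i u → v ∉ T → t ∈ T → Reach A T u t → Reach A T v t →
      Linked A T i v

theorem Linked.notMem {u : V} (h : Linked A T i u) : u ∉ T := by
  cases h <;> assumption

theorem Linked.parent {u v : V} (h : Linked A T i u) (hv : v ∉ T) (hvu : A v u) :
    Linked A T i v := by
  cases h with
  | start _ h => exact .start hv (h.head ⟨hvu, hv⟩)
  | link h _ ht h1 h2 => exact .link h hv ht h1 (h2.head ⟨hvu, hv⟩)

theorem Ancestor.exists_reach {u d : V} (hu : u ∉ T) (hd : d ∈ T) (h : Ancestor A u d) :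
    ∃ t ∈ T, Reach A T u t := by
  induction h using Relation.TransGen.head_induction_on with
  | single h => exact ⟨d, hd, .single ⟨h, hu⟩⟩
  | @head a c hac _ ih =>
    by_cases hc : c ∈ T
    · exact ⟨c, hc, .single ⟨hac, hu⟩⟩
    · obtain ⟨t, ht, h⟩ := ih hc
      exact ⟨t, ht, h.head ⟨hac, hu⟩⟩

theorem DConn.exists_linked (hA : IsDAG A) (hi : i ∉ T) (hj : j ∉ T) (h : DConn A T i j) :
    ∃ s, Linked A T i s ∧ Reach A T s j := by
  obtain ⟨n, w, -, h0, hlast, hadj, hpass⟩ := h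
  have key : ∀ (k : ℕ) (hk : k + 1 < n + 2),
      (A (w ⟨k, by omega⟩) (w ⟨k + 1, hk⟩) ∧
        ∃ s, Linked A T i s ∧ Reach A T s (w ⟨k + 1, hk⟩)) ∨
      (A (w ⟨k + 1, hk⟩) (w ⟨k, by omega⟩) ∧ Linked A T i (w ⟨k + 1, hk⟩)) := by
    intro k hk
    have hout : A (w ⟨k + 1, hk⟩) (w ⟨k, by omega⟩) → w ⟨k + 1, hk⟩ ∉ T := by
      intro hup
      rcases Nat.lt_or_ge (k + 2) (n + 2) with h' | h'
      · exact (hpass k h').2 fun hc => hA.asymm hup hc.1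
      · have : (⟨k + 1, hk⟩ : Fin (n + 2)) = Fin.last (n + 1) := by
          ext; simp; omega
        rwa [this, hlast]
    induction k with
    | zero =>
      have hs : Linked A T i (w ⟨0, by omega⟩) := by
        have : w ⟨0, by omega⟩ = i := h0
        rw [this]
        exact .start hi .refl
      rcases hadj 0 hk with h | h
      · exact Or.inl ⟨h, _, hs, .single ⟨h, hs.notMem⟩⟩
      · exact Or.inr ⟨h, hs.parent (hout h) h⟩
    | succ k ih =>
      have hprev := ih (by omega) (by
        intro hup
        exact (hpass k hk).2 fun hc => hA.asymm hup hc.1)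
      have hp := hpass k hk
      rcases hadj (k + 1) hk with h | h
      · have hnT := hp.2 fun hc => hA.asymm h hc.2
        refine Or.inl ⟨h, ?_⟩
        obtain ⟨-, s, hs, hr⟩ | ⟨-, hs⟩ := hprev
        · exact ⟨s, hs, hr.tail ⟨h, hnT⟩⟩
        · exact ⟨_, hs, .single ⟨h, hnT⟩⟩
      · refine Or.inr ⟨h, ?_⟩
        have hw := hout h
        obtain ⟨h1, s, hs, hr⟩ | ⟨-, hs⟩ := hprev
        · obtain ⟨t, ht, hut⟩ : ∃ t ∈ T, Reach A T (w ⟨k + 1, by omega⟩) t := by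
            by_cases huT : w ⟨k + 1, by omega⟩ ∈ T
            · exact ⟨_, huT, .refl⟩
            · rcases hp.1 ⟨h1, h⟩ with h' | ⟨d, hd, h'⟩
              · exact (huT h').elim
              · exact Ancestor.exists_reach huT hd h'
          exact .link hs hw ht (hr.trans hut) (hut.head ⟨h, hw⟩)
        · exact hs.parent hw h
  have hlast' : w ⟨n + 1, by omega⟩ = j := hlast
  rcases key n (by omega) with ⟨-, h⟩ | ⟨-, h⟩
  · rwa [hlast'] at h
  · rw [hlast'] at h
    exact ⟨j, h, .refl⟩

/-- `f 0, …, f m` are nodes outside `T`, consecutive ones reach a common node of `T`, the first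
one reaches `i`, and the last one reaches `j`. -/
structure IsLinkChain (A : V → V → Prop) (T : Set V) (i j : V) (m : ℕ) (f : ℕ → V) : Prop where
  notMem : ∀ k ≤ m, f k ∉ T
  first : Reach A T (f 0) i
  last : Reach A T (f m) j
  link : ∀ k < m, ∃ t ∈ T, Reach A T (f k) t ∧ Reach A T (f (k + 1)) t

theorem Linked.exists_isLinkChain {s : V} (h : Linked A T i s) (hs : Reach A T s j) :
    ∃ m f, IsLinkChain A T i j m f := by
  suffices ∃ m f, IsLinkChain A T i s m f ∧ f m = s by
    obtain ⟨m, f, h, rfl⟩ := this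
    exact ⟨m, f, h.notMem, h.first, hs, h.link⟩
  clear hs
  induction h with
  | @start u hu hr => exact ⟨0, fun _ => u, ⟨fun _ _ => hu, hr, .refl, by simp⟩, rfl⟩
  | @link u v t _ hv ht hut hvt ih =>
    obtain ⟨m, f, h, rfl⟩ := ih
    refine ⟨m + 1, fun k => if k ≤ m then f k else v, ⟨fun k _ => ?_, by simpa using h.first,
      by rw [if_neg (by omega)]; exact .refl, fun k hk => ?_⟩, by simp⟩
    · split_ifs with h'
      · exact h.notMem k h'
      · exact hv
    · rcases Nat.lt_succ_iff_lt_or_eq.1 hk with h' | rfl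
      · simpa [h'.le, Nat.succ_le_of_lt h'] using h.link k h'
      · exact ⟨t, ht, by simpa using hut, by simpa using hvt⟩

/-- A link chain of minimal length. -/
structure IsShortestLinkChain (A : V → V → Prop) (T : Set V) (i j : V) (m : ℕ) (f : ℕ → V) : Prop
    extends IsLinkChain A T i j m f where
  minimal : ∀ m' f', IsLinkChain A T i j m' f' → m ≤ m'

theorem DConn.exists_isShortestLinkChain (hA : IsDAG A) (hi : i ∉ T) (hj : j ∉ T)
    (h : DConn A T i j) : ∃ m f, IsShortestLinkChain A T i j m f := by
  obtain ⟨s, hs, hsj⟩ := h.exists_linked hA hi hj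
  have h := hs.exists_isLinkChain hsj
  obtain ⟨f, hf⟩ := Nat.find_spec h
  exact ⟨_, f, hf, fun m' f' h' => Nat.find_min' h ⟨f', h'⟩⟩

namespace IsShortestLinkChain

variable {m : ℕ} {f : ℕ → V}

theorem eq_zero_of_reach (h : IsShortestLinkChain A T i j m f) {a : ℕ} (ha : a ≤ m)
    (hr : Reach A T (f a) i) : a = 0 := by
  have := h.minimal (m - a) (fun k => f (k + a)) ⟨fun k hk => h.notMem _ (by omega),
    by simpa using hr, by simpa [ha] using h.last, fun k hk => by
      have := h.link (k + a) (by omega)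
      rwa [show k + a + 1 = k + 1 + a by omega] at this⟩
  omega

theorem eq_last_of_reach (h : IsShortestLinkChain A T i j m f) {a : ℕ} (ha : a ≤ m)
    (hr : Reach A T (f a) j) : a = m := by
  have := h.minimal a f ⟨fun k hk => h.notMem _ (by omega), h.first, hr,
    fun k hk => h.link k (by omega)⟩
  omega

theorem le_succ_of_reach (h : IsShortestLinkChain A T i j m f) {a b : ℕ} (hb : b ≤ m) {t : V}
    (ht : t ∈ T) (hat : Reach A T (f a) t) (hbt : Reach A T (f b) t) : b ≤ a + 1 := by
  by_contra! hlt
  obtain ⟨d, rfl⟩ := Nat.exists_eq_add_of_le hlt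
  have := h.minimal (m - d - 1) (fun k => if k ≤ a then f k else f (k + d + 1))
    ⟨fun k hk => ?_, by simpa using h.first, ?_, fun k hk => ?_⟩
  · omega
  · split_ifs <;> exact h.notMem _ (by omega)
  · rw [if_neg (by omega), show m - d - 1 + d + 1 = m by omega]
    exact h.last
  · rcases lt_trichotomy k a with h' | rfl | h'
    · simpa [h'.le, Nat.succ_le_of_lt h'] using h.link k (by omega)
    · refine ⟨t, ht, by simpa using hat, ?_⟩
      rw [if_neg (by omega)]
      rwa [show k + 1 + d + 1 = k + 1 + 1 + d by omega]
    · have := h.link (k + d + 1) (by omega)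
      rw [if_neg (by omega), if_neg (by omega)]
      rwa [show k + d + 1 + 1 = k + 1 + d + 1 by omega] at this

theorem eq_of_reach (h : IsShortestLinkChain A T i j m f) {a b : ℕ} (ha : a ≤ m) (hb : b ≤ m)
    (hr : Reach A T (f b) (f a)) : b = a := by
  rcases lt_trichotomy a b with hab | hab | hab
  · cases a with
    | zero => exact h.eq_zero_of_reach hb (hr.trans h.first)
    | succ a =>
      obtain ⟨t, ht, h1, h2⟩ := h.link a (by omega)
      have := h.le_succ_of_reach hb ht h1 (hr.trans h2)
      omega
  · exact hab.symm
  · rcases ha.lt_or_eq with hlt | rfl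
    · obtain ⟨t, ht, h1, h2⟩ := h.link a hlt
      have := h.le_succ_of_reach hlt ht (hr.trans h1) h2
      omega
    · exact h.eq_last_of_reach hb (hr.trans h.last)

end IsShortestLinkChain

end Chains

section Dependence

variable {A : V → V → Prop} {T : Set V} {i j : V}

/-- The sum modulo two of the coins `c a` with `a ∈ s`. -/
def coinSum (c : ℕ → Bool) (s : Finset ℕ) : Bool := decide (Odd (s.filter (c · = true)).card)

theorem coinSum_empty (c : ℕ → Bool) : coinSum c ∅ = false := by simp [coinSum]

theorem coinSum_singleton (c : ℕ → Bool) (a : ℕ) : coinSum c {a} = c a := by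
  cases h : c a <;> simp [coinSum, Finset.filter_singleton, h]

theorem coinSum_pair (c : ℕ → Bool) {a b : ℕ} (hab : a ≠ b) :
    coinSum c {a, b} = xor (c a) (c b) := by
  have : ¬ Odd 2 := by decide
  cases h : c a <;> cases h' : c b <;>
    simp [coinSum, Finset.filter_insert, Finset.filter_singleton, h, h', hab, this]

/-- The indices at most `m` of the nodes `f a` that reach `v`. -/
noncomputable def reachers (A : V → V → Prop) (T : Set V) (m : ℕ) (f : ℕ → V) (v : V) :
    Finset ℕ :=
  (Finset.range (m + 1)).filter fun a => Reach A T (f a) v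

theorem mem_reachers {m : ℕ} {f : ℕ → V} {v : V} {a : ℕ} :
    a ∈ reachers A T m f v ↔ a ≤ m ∧ Reach A T (f a) v := by
  simp [reachers]

theorem reachers_subset {m : ℕ} {f : ℕ → V} {p v : V} (hp : p ∉ T) (hpv : A p v) :
    reachers A T m f p ⊆ reachers A T m f v := fun a ha => by
  rw [mem_reachers] at ha ⊢
  exact ⟨ha.1, ha.2.tail ⟨hpv, hp⟩⟩

theorem exists_parent_of_mem_reachers {m : ℕ} {f : ℕ → V} {v : V} (hv : ∀ a ≤ m, f a ≠ v) {a : ℕ}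
    (ha : a ∈ reachers A T m f v) : ∃ p, A p v ∧ p ∉ T ∧ a ∈ reachers A T m f p := by
  rw [mem_reachers] at ha
  rcases Relation.ReflTransGen.cases_tail ha.2 with h | ⟨p, h, hpv, hp⟩
  · exact (hv a ha.1 h.symm).elim
  · exact ⟨p, hpv, hp, mem_reachers.2 ⟨ha.1, h⟩⟩

/-- At a node reached by at most two of the `f a`, the sum of the coins that reach it is a function
of the corresponding sums at its parents. -/
theorem exists_coinSum_rule {m : ℕ} {f : ℕ → V} {v : V} (hv : ∀ a ≤ m, f a ≠ v)
    (hcard : (reachers A T m f v).card ≤ 2) :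
    ∃ g : (V → Bool) → Bool, (∀ x y, (∀ u, A u v → x u = y u) → g x = g y) ∧
      ∀ c x, (∀ p, A p v → p ∉ T → x p = coinSum c (reachers A T m f p)) →
        g x = coinSum c (reachers A T m f v) := by
  rcases (reachers A T m f v).eq_empty_or_nonempty with h0 | ⟨a, ha⟩
  · exact ⟨fun _ => false, by simp, fun c x _ => by rw [h0, coinSum_empty]⟩
  by_cases hcopy : ∃ p, A p v ∧ p ∉ T ∧ reachers A T m f p = reachers A T m f v
  · obtain ⟨p, hpv, hp, h⟩ := hcopy
    exact ⟨fun x => x p, fun x y hxy => hxy p hpv, fun c x hx => (hx p hpv hp).trans (by rw [h])⟩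
  push Not at hcopy
  have hsingle : ∀ a ∈ reachers A T m f v, ∃ p, A p v ∧ p ∉ T ∧ reachers A T m f p = {a} := by
    intro a ha
    obtain ⟨p, hpv, hp, hap⟩ := exists_parent_of_mem_reachers hv ha
    have hss := Finset.card_lt_card ((reachers_subset hp hpv).ssubset_of_ne (hcopy p hpv hp))
    refine ⟨p, hpv, hp, ?_⟩
    exact (Finset.eq_of_subset_of_card_le (Finset.singleton_subset_iff.2 hap)
      (by rw [Finset.card_singleton]; omega)).symm
  obtain ⟨p, hpv, hp, hap⟩ := hsingle a ha
  obtain ⟨b, hb, hba⟩ : ∃ b ∈ reachers A T m f v, b ≠ a := by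
    by_contra! hall
    exact hcopy p hpv hp (hap.trans (Finset.eq_singleton_iff_unique_mem.2 ⟨ha, hall⟩).symm)
  obtain ⟨q, hqv, hq, hbq⟩ := hsingle b hb
  have hpair : reachers A T m f v = {a, b} := by
    refine (Finset.eq_of_subset_of_card_le ?_ ?_).symm
    · intro z hz
      rcases Finset.mem_insert.1 hz with rfl | hz
      · exact ha
      · rwa [Finset.mem_singleton.1 hz]
    · rw [Finset.card_pair hba.symm]; exact hcard
  refine ⟨fun x => xor (x p) (x q), fun x y hxy => by simp only [hxy p hpv, hxy q hqv],
    fun c x hx => ?_⟩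
  beta_reduce
  rw [hx p hpv hp, hx q hqv hq, hap, hbq, hpair, coinSum_singleton, coinSum_singleton,
    coinSum_pair c hba.symm]

variable [DecidableEq V] [Fintype V]

/-- For every d-connected pair there is a distribution that factorizes along the DAG and in which
the pair is conditionally dependent. -/
theorem DConn.exists_dependent (hA : IsDAG A) (hij : i ≠ j) (hi : i ∉ T) (hj : j ∉ T)
    (h : DConn A T i j) : ∃ θ, IsKernel A θ ∧ ∃ a : V → Bool,
      margin (S := fun _ : V => Bool) (joint θ) ({i} ∪ {j} ∪ T) a *
          margin (S := fun _ : V => Bool) (joint θ) T a ≠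
        margin (S := fun _ : V => Bool) (joint θ) ({i} ∪ T) a *
          margin (S := fun _ : V => Bool) (joint θ) ({j} ∪ T) a := by
  obtain ⟨m, f, hf⟩ := h.exists_isShortestLinkChain hA hi hj
  set R : V → Finset ℕ := reachers A T m f with hR
  have hex : ∀ v, ∃ g : (V → Bool) → Bool, (∀ x y, (∀ u, A u v → x u = y u) → g x = g y) ∧
      ((∀ a ≤ m, f a ≠ v) → (R v).card ≤ 2 →
        ∀ c x, (∀ p, A p v → p ∉ T → x p = coinSum c (R p)) → g x = coinSum c (R v)) := by
    intro v
    by_cases hv : (∀ a ≤ m, f a ≠ v) ∧ (R v).card ≤ 2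
    · obtain ⟨g, h1, h2⟩ := exists_coinSum_rule hv.1 hv.2
      exact ⟨g, h1, fun _ _ => h2⟩
    · exact ⟨fun _ => false, by simp, fun h1 h2 => (hv ⟨h1, h2⟩).elim⟩
  choose g hloc hg using hex
  set act : V → Prop := fun v => (v ∉ T ∧ (R v).card ≤ 2) ∨ (v ∈ T ∧ (R v).card = 2) with hact
  have hact2 : ∀ v, act v → (R v).card ≤ 2 := by
    rintro v (h | h) <;> omega
  have hactp : ∀ v, act v → ∀ p, A p v → p ∉ T → act p := fun v hv p hpv hp =>
    Or.inl ⟨hp, (Finset.card_le_card (reachers_subset hp hpv)).trans (hact2 v hv)⟩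
  have hRsource : ∀ a ≤ m, R (f a) = {a} := fun a ha => by
    refine Finset.eq_singleton_iff_unique_mem.2 ⟨mem_reachers.2 ⟨ha, .refl⟩, fun b hb => ?_⟩
    rw [mem_reachers] at hb
    exact hf.eq_of_reach ha hb.1 hb.2
  have hactsource : ∀ a ≤ m, act (f a) := fun a ha =>
    Or.inl ⟨hf.notMem a ha, by rw [hRsource a ha]; simp⟩
  have hRi : R i = {0} := Finset.eq_singleton_iff_unique_mem.2
    ⟨mem_reachers.2 ⟨by omega, hf.first⟩, fun b hb => by
      rw [mem_reachers] at hb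
      exact hf.eq_zero_of_reach hb.1 hb.2⟩
  have hRj : R j = {m} := Finset.eq_singleton_iff_unique_mem.2
    ⟨mem_reachers.2 ⟨le_rfl, hf.last⟩, fun b hb => by
      rw [mem_reachers] at hb
      exact hf.eq_last_of_reach hb.1 hb.2⟩
  have hacti : act i := Or.inl ⟨hi, by rw [hRi]; simp⟩
  have hactj : act j := Or.inl ⟨hj, by rw [hRj]; simp⟩
  have hRt : ∀ t ∈ T, ∀ a ∈ R t, ∀ b ∈ R t, b ≤ a + 1 := fun t ht a ha b hb => by
    rw [mem_reachers] at ha hb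
    exact hf.le_succ_of_reach hb.1 ht ha.2 hb.2
  set θ : V → (V → Bool) → ℝ := fun v x =>
    if ∃ a ≤ m, f a = v then 1 / 2 else if act v then (if g v x then 1 else 0) else 0 with hθdef
  have hθ : IsKernel A θ := by
    refine fun v x => ⟨?_, ?_, fun y hxy => ?_⟩
    · simp only [hθdef]; split_ifs <;> norm_num
    · simp only [hθdef]; split_ifs <;> norm_num
    · simp only [hθdef, hloc v x y hxy]
  have hsupp : ∀ x, joint θ x ≠ 0 → ∀ v, act v → x v = coinSum (fun a => x (f a)) (R v) := by
    intro x hx v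
    have hwf : WellFounded (Ancestor A) := by
      have : IsTrans V (Ancestor A) := ⟨fun a b c h1 h2 => Relation.TransGen.trans h1 h2⟩
      have : Std.Irrefl (Ancestor A) := ⟨fun a => hA a⟩
      exact Finite.wellFounded_of_trans_of_irrefl _
    induction v using hwf.induction with
    | _ v ih =>
      intro hv
      by_cases hs : ∃ a ≤ m, f a = v
      · obtain ⟨a, ha, rfl⟩ := hs
        rw [hRsource a ha, coinSum_singleton]
      · have hv0 : factor θ v x ≠ 0 := Finset.prod_ne_zero_iff.1 hx v (Finset.mem_univ v)
        have hxg : x v = g v x := by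
          simp only [factor, hθdef, if_neg hs, if_pos hv] at hv0
          cases h1 : x v <;> cases h2 : g v x <;> simp [h1, h2] at hv0 ⊢
        push Not at hs
        rw [hxg]
        exact hg v hs (hact2 v hv) _ x fun p hpv hp =>
          ih p (.single hpv) (hactp v hv p hpv hp)
  have hpos : ∀ c : ℕ → Bool,
      0 < joint θ fun v => if act v then coinSum c (R v) else false := by
    intro c
    refine Finset.prod_pos fun v _ => ?_
    by_cases hs : ∃ a ≤ m, f a = v
    · simp only [factor, hθdef, if_pos hs]
      split_ifs <;> norm_num
    · by_cases hv : act v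
      · simp only [factor, hθdef, if_neg hs, if_pos hv]
        push Not at hs
        rw [hg v hs (hact2 v hv) c _ fun p hpv hp => if_pos (hactp v hv p hpv hp)]
        cases coinSum c (R v) <;> simp
      · simp [factor, hθdef, if_neg hs, if_neg hv]
  refine ⟨θ, hθ, fun v => decide (v = i), ?_⟩
  have hzero : margin (S := fun _ : V => Bool) (joint θ) ({i} ∪ {j} ∪ T)
      (fun v => decide (v = i)) = 0 := by
    rw [margin_eq_sum]
    refine Finset.sum_eq_zero fun x _ => ?_
    split_ifs with hx
    · by_contra hne
      have hval := hsupp x hne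
      have hxi : x i = true := by simpa using hx i (by simp)
      have hxj : x j = false := by simpa [hij.symm] using hx j (by simp)
      have hall : ∀ k ≤ m, x (f k) = true := by
        intro k
        induction k with
        | zero =>
          intro _
          have := hval i hacti
          rwa [hRi, coinSum_singleton, hxi, eq_comm] at this
        | succ k ih =>
          intro hk
          obtain ⟨t, ht, h1, h2⟩ := hf.link k hk
          have m1 : k ∈ R t := mem_reachers.2 ⟨by omega, h1⟩
          have m2 : k + 1 ∈ R t := mem_reachers.2 ⟨hk, h2⟩
          have hRtk : R t = {k, k + 1} := by
            ext b
            simp only [Finset.mem_insert, Finset.mem_singleton]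
            refine ⟨fun hb => ?_, ?_⟩
            · have := hRt t ht k m1 b hb
              have := hRt t ht b hb _ m2
              omega
            · rintro (rfl | rfl) <;> assumption
          have hactt : act t := Or.inr ⟨ht, by rw [hRtk, Finset.card_pair (by omega)]⟩
          have hti : t ≠ i := fun h => hi (h ▸ ht)
          have hxt : x t = false := by simpa [hti] using hx t (by simp [ht])
          have := hval t hactt
          rw [hRtk, coinSum_pair _ (by omega), hxt, ih (by omega)] at this
          simpa using this
      have := hval j hactj
      rw [hRj, coinSum_singleton, hxj, hall m le_rfl] at this
      exact Bool.noConfusion this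
    · rfl
  have hmargin : ∀ (X : Set V) (c : ℕ → Bool) (a : V → Bool),
      (∀ v ∈ X, (if act v then coinSum c (R v) else false) = a v) →
        0 < margin (S := fun _ : V => Bool) (joint θ) X a := by
    intro X c a hX
    rw [margin_eq_sum]
    refine Finset.sum_pos' (fun x _ => ?_)
      ⟨fun v => if act v then coinSum c (R v) else false, Finset.mem_univ _, ?_⟩
    · split_ifs
      · exact hθ.joint_nonneg x
      · exact le_rfl
    · rw [if_pos hX]
      exact hpos c
  have h1 := hmargin ({i} ∪ T) (fun _ => true) (fun v => decide (v = i)) (by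
    rintro v (rfl | hv)
    · rw [if_pos hacti, hRi, coinSum_singleton]; simp
    · have hvi : v ≠ i := fun h => hi (h ▸ hv)
      have : ¬ Odd 2 := by decide
      by_cases hav : act v
      · have hc : (R v).card = 2 := by
          rcases hav with h | h
          · exact (h.1 hv).elim
          · exact h.2
        simp [hav, coinSum, hvi, hc, this]
      · simp [hav, hvi])
  have h2 := hmargin ({j} ∪ T) (fun _ => false) (fun v => decide (v = i)) (by
    intro v hv
    have hvi : v ≠ i := by
      rintro rfl
      rcases hv with h | h
      · exact hij h
      · exact hi h
    simp [coinSum, hvi])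
  rw [hzero, zero_mul]
  exact (mul_pos h1 h2).ne

end Dependence

section Generic

open Polynomial in
/-- If each of finitely many functions is polynomial along lines, then a convex set contains a
point at which none of them vanishes, except those that vanish on the whole set. -/
theorem exists_forall_ne_zero_of_polynomial {E κ : Type*} [AddCommGroup E] [Module ℝ E]
    [Fintype κ] {C : Set E} (hC : Convex ℝ C) (hne : C.Nonempty) (D : κ → E → ℝ)
    (hD : ∀ k x y, ∃ P : ℝ[X], ∀ t : ℝ, P.eval t = D k (AffineMap.lineMap x y t)) :
    ∃ x ∈ C, ∀ k, (∃ y ∈ C, D k y ≠ 0) → D k x ≠ 0 := by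
  suffices ∀ s : Finset κ, ∃ x ∈ C, ∀ k ∈ s, (∃ y ∈ C, D k y ≠ 0) → D k x ≠ 0 by
    simpa using this Finset.univ
  intro s
  induction s using Finset.induction_on with
  | empty =>
    obtain ⟨x, hx⟩ := hne
    exact ⟨x, hx, by simp⟩
  | insert k s _ ih =>
    obtain ⟨x, hx, hxs⟩ := ih
    by_cases hk : ∃ y ∈ C, D k y ≠ 0
    swap
    · refine ⟨x, hx, fun l hl hw => ?_⟩
      rcases Finset.mem_insert.1 hl with rfl | hl
      · exact (hk hw).elim
      · exact hxs l hl hw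
    obtain ⟨y, hy, hky⟩ := hk
    choose P hP using fun l => hD l x y
    have hP0 : ∀ l ∈ insert k s, (∃ y ∈ C, D l y ≠ 0) → P l ≠ 0 := by
      intro l hl hw h0
      rcases Finset.mem_insert.1 hl with rfl | hl
      · have := hP l 1
        rw [h0, eval_zero, AffineMap.lineMap_apply_one] at this
        exact hky this.symm
      · have := hP l 0
        rw [h0, eval_zero, AffineMap.lineMap_apply_zero] at this
        exact hxs l hl hw this.symm
    set s' := (insert k s).filter fun l => ∃ y ∈ C, D l y ≠ 0 with hs'
    have hQ : ∏ l ∈ s', P l ≠ 0 := Finset.prod_ne_zero_iff.2 fun l hl =>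
      hP0 l (Finset.mem_filter.1 hl).1 (Finset.mem_filter.1 hl).2
    obtain ⟨t, ht, hroot⟩ :=
      (Set.Icc_infinite (zero_lt_one (α := ℝ))).exists_notMem_finset (∏ l ∈ s', P l).roots.toFinset
    refine ⟨AffineMap.lineMap x y t, hC.lineMap_mem hx hy ht, fun l hl hw h0 => hroot ?_⟩
    rw [Multiset.mem_toFinset, mem_roots hQ, IsRoot.def, eval_prod]
    exact Finset.prod_eq_zero (Finset.mem_filter.2 ⟨hl, hw⟩) ((hP l t).trans h0)

variable {A : V → V → Prop}

theorem convex_isKernel : Convex ℝ {θ : V → (V → Bool) → ℝ | IsKernel A θ} := by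
  intro θ hθ η hη a b ha hb hab v f
  obtain ⟨h1, h2, h3⟩ := hθ v f
  obtain ⟨h1', h2', h3'⟩ := hη v f
  simp only [Pi.add_apply, Pi.smul_apply, smul_eq_mul]
  refine ⟨by positivity, by nlinarith, fun g hg => by rw [h3 g hg, h3' g hg]⟩

variable [DecidableEq V] [Fintype V]

open Polynomial in
theorem exists_polynomial_margin (X : Set V) (a : V → Bool) (θ η : V → (V → Bool) → ℝ) :
    ∃ P : ℝ[X], ∀ t : ℝ, P.eval t =
      margin (S := fun _ : V => Bool) (joint (AffineMap.lineMap θ η t)) X a := by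
  refine ⟨∑ f : V → Bool, if ∀ v ∈ X, f v = a v then
    ∏ v, (if f v then C (θ v f) + Polynomial.X * C (η v f - θ v f)
      else 1 - (C (θ v f) + Polynomial.X * C (η v f - θ v f))) else 0, fun t => ?_⟩
  rw [margin_eq_sum, eval_finsetSum]
  refine Finset.sum_congr rfl fun f _ => ?_
  split_ifs with h
  · rw [eval_prod]
    refine Finset.prod_congr rfl fun v _ => ?_
    have : (AffineMap.lineMap θ η t : V → (V → Bool) → ℝ) v f = θ v f + t * (η v f - θ v f) := by
      simp [AffineMap.lineMap_apply]
      ring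
    unfold factor
    rw [this]
    split_ifs <;> simp
  · simp

theorem margin_nonneg {p : (V → Bool) → ℝ} (hp : ∀ f, 0 ≤ p f) (X : Set V) (a : V → Bool) :
    0 ≤ margin (S := fun _ : V => Bool) p X a := by
  rw [margin_eq_sum]
  exact Finset.sum_nonneg fun f _ => by split_ifs; exacts [hp f, le_rfl]

theorem margin_anti {p : (V → Bool) → ℝ} (hp : ∀ f, 0 ≤ p f) {X Y : Set V} (h : X ⊆ Y)
    (a : V → Bool) :
    margin (S := fun _ : V => Bool) p Y a ≤ margin (S := fun _ : V => Bool) p X a := by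
  rw [margin_eq_sum, margin_eq_sum]
  refine Finset.sum_le_sum fun f _ => ?_
  by_cases hY : ∀ v ∈ Y, f v = a v
  · rw [if_pos hY, if_pos fun v hv => hY v (h hv)]
  · rw [if_neg hY]
    split_ifs
    exacts [hp f, le_rfl]

theorem CondIndep.eq {p : (V → Bool) → ℝ} (hp : ∀ f, 0 ≤ p f) {X Y Z : Set V}
    (h : CondIndep (S := fun _ : V => Bool) p X Y Z) (a : V → Bool) :
    margin (S := fun _ : V => Bool) p (X ∪ Y ∪ Z) a * margin (S := fun _ : V => Bool) p Z a =
      margin (S := fun _ : V => Bool) p (X ∪ Z) a *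
        margin (S := fun _ : V => Bool) p (Y ∪ Z) a := by
  rcases (margin_nonneg hp Z a).eq_or_lt with h0 | h0
  · have hle := margin_anti hp (Set.subset_union_right (s := X) (t := Z)) a
    rw [← h0] at hle
    rw [← h0, hle.antisymm (margin_nonneg hp _ a), mul_zero, zero_mul]
  · exact h a h0

/-- Every DAG has a binary distribution in which the conditional independencies between pairs of
nodes are exactly the d-separations; the node `s` can be required not to be a fair coin. -/
theorem exists_faithful_kernel (hA : IsDAG A) (s : V) : ∃ θ, IsKernel A θ ∧
    (∀ i j : V, i ≠ j → ∀ T : Set V, i ∉ T → j ∉ T →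
      (CondIndep (S := fun _ : V => Bool) (joint θ) {i} {j} T ↔ DSep A T i j)) ∧
    margin (S := fun _ : V => Bool) (joint θ) {s} (fun _ => true) ≠ 1 / 2 := by
  let M (X : Set V) (a : V → Bool) (θ : V → (V → Bool) → ℝ) : ℝ :=
    margin (S := fun _ : V => Bool) (joint θ) X a
  let D : Option (V × V × Set V × (V → Bool)) → (V → (V → Bool) → ℝ) → ℝ := fun k θ =>
    match k with
    | none => M {s} (fun _ => true) θ - 1 / 2
    | some (i, j, T, a) =>
      M ({i} ∪ {j} ∪ T) a θ * M T a θ - M ({i} ∪ T) a θ * M ({j} ∪ T) a θ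
  have htrue : IsKernel A fun _ _ => (1 : ℝ) := fun v f => ⟨by simp, by simp, by simp⟩
  obtain ⟨θ, hθ, hgen⟩ := exists_forall_ne_zero_of_polynomial (convex_isKernel (A := A))
    ⟨_, htrue⟩ D (by
      intro k θ η
      have hM := fun X a => exists_polynomial_margin X a θ η
      choose P hP using hM
      rcases k with _ | ⟨i, j, T, a⟩
      · exact ⟨P {s} (fun _ => true) - Polynomial.C (1 / 2), fun t => by simp [D, M, hP]⟩
      · exact ⟨P ({i} ∪ {j} ∪ T) a * P T a - P ({i} ∪ T) a * P ({j} ∪ T) a,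
          fun t => by simp only [D, M, hP, Polynomial.eval_sub, Polynomial.eval_mul]⟩)
  have hθ' : IsKernel A θ := hθ
  refine ⟨θ, hθ', fun i j hij T hi hj => ⟨fun hci hcon => ?_,
    fun hsep => hθ'.condIndep_joint hA hij hi hj hsep⟩, fun h => ?_⟩
  · obtain ⟨η, hη, a, hne⟩ := hcon.exists_dependent hA hij hi hj
    exact hgen (some (i, j, T, a)) ⟨η, hη, sub_ne_zero.2 hne⟩
      (sub_eq_zero.2 (hci.eq hθ'.joint_nonneg a))
  · refine hgen none ⟨_, htrue, ?_⟩ (sub_eq_zero.2 h)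
    have h1 : joint (fun _ _ => (1 : ℝ)) (fun _ : V => true) = 1 := by simp [joint, factor]
    have h2 : (1 : ℝ) ≤ M {s} (fun _ => true) fun _ _ => 1 := by
      simp only [M]
      rw [margin_eq_sum]
      refine le_trans ?_ (Finset.single_le_sum (fun f _ => ?_)
        (Finset.mem_univ fun _ : V => true))
      · simp [h1]
      · split_ifs
        exacts [htrue.joint_nonneg f, le_rfl]
    simp only [D]
    intro h0
    linarith

end Generic

section Parity

variable [Fintype V]

/-- The parity of the values of `f` on each group. -/
noncomputable def parity (π : V → I) (f : V → Bool) (i : I) : Bool :=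
  decide (Odd (Finset.univ.filter fun v => π v = i ∧ f v = true).card)

/-- The parity of the values of `f` on the group of `x`, leaving out `x` itself. -/
noncomputable def parityOff (π : V → I) (x : V) (f : V → Bool) : Bool :=
  decide (Odd (Finset.univ.filter fun v => v ≠ x ∧ π v = π x ∧ f v = true).card)

variable {π : V → I}

theorem parity_congr {f g : V → Bool} {i : I} (h : ∀ v, π v = i → f v = g v) :
    parity π f i = parity π g i := by
  unfold parity
  congr! 4 with v
  constructor <;> rintro ⟨h1, h2⟩ <;> refine ⟨h1, ?_⟩
  · rwa [← h v h1]
  · rwa [h v h1]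

theorem parityOff_congr {f g : V → Bool} {x : V} (h : ∀ v, v ≠ x → π v = π x → f v = g v) :
    parityOff π x f = parityOff π x g := by
  unfold parityOff
  congr! 4 with v
  constructor <;> rintro ⟨h0, h1, h2⟩ <;> refine ⟨h0, h1, ?_⟩
  · rwa [← h v h0 h1]
  · rwa [h v h0 h1]

theorem parity_eq_xor (x : V) (f : V → Bool) :
    parity π f (π x) = xor (f x) (parityOff π x f) := by
  unfold parity parityOff
  set s := Finset.univ.filter fun v => v ≠ x ∧ π v = π x ∧ f v = true with hs
  cases hx : f x
  · have : (Finset.univ.filter fun v => π v = π x ∧ f v = true) = s := by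
      ext v
      simp only [hs, Finset.mem_filter, Finset.mem_univ, true_and]
      refine ⟨fun h => ⟨?_, h⟩, fun h => h.2⟩
      rintro rfl
      simp [hx] at h
    rw [this, Bool.false_xor]
  · have : (Finset.univ.filter fun v => π v = π x ∧ f v = true) = insert x s := by
      ext v
      simp only [hs, Finset.mem_filter, Finset.mem_univ, true_and, Finset.mem_insert]
      refine ⟨fun h => or_iff_not_imp_left.2 fun hv => ⟨hv, h⟩, ?_⟩
      rintro (rfl | h)
      · exact ⟨rfl, hx⟩
      · exact h.2
    rw [this, Finset.card_insert_of_notMem (by simp [hs]), Bool.true_xor]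
    simp [Nat.odd_add_one, decide_not, -Nat.not_odd_iff_even]

/-- Replace the value at the representative of each group by the parity of the group. -/
noncomputable def parityCoord (π : V → I) (r : I → V) (f : V → Bool) (v : V) : Bool :=
  if v = r (π v) then parity π f (π v) else f v

theorem parityCoord_congr (r : I → V) {f g : V → Bool} {i : I} (h : ∀ v, π v = i → f v = g v)
    (v : V) (hv : π v = i) : parityCoord π r f v = parityCoord π r g v := by
  unfold parityCoord
  subst hv
  rw [parity_congr h, h v rfl]

theorem parity_parityCoord {r : I → V} (hr : ∀ i, π (r i) = i) (f : V → Bool) (i : I) :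
    parity π (parityCoord π r f) i = f (r i) := by
  have h1 := parity_eq_xor (π := π) (r i) (parityCoord π r f)
  have h2 := parity_eq_xor (π := π) (r i) f
  rw [parityOff_congr (g := f)] at h1
  · rw [hr] at h1 h2
    have h3 : parityCoord π r f (r i) = parity π f i := by simp [parityCoord, hr]
    rw [h1, h3, h2, Bool.xor_assoc, Bool.xor_self, Bool.xor_false]
  · intro v hv hvi
    rw [hr] at hvi
    exact if_neg (by rwa [hvi])

theorem parityCoord_parityCoord {r : I → V} (hr : ∀ i, π (r i) = i) (f : V → Bool) :
    parityCoord π r (parityCoord π r f) = f := by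
  funext v
  by_cases hv : v = r (π v)
  · rw [parityCoord, if_pos hv, parity_parityCoord hr, ← hv]
  · rw [parityCoord, if_neg hv, parityCoord, if_neg hv]

theorem exists_parity_eq (hπ : Function.Surjective π) (g : I → Bool) :
    ∃ f : V → Bool, parity π f = g := by
  obtain ⟨r, hr⟩ := hπ.hasRightInverse
  refine ⟨parityCoord π r (g ∘ π), funext fun i => ?_⟩
  rw [parity_parityCoord hr, Function.comp_apply, hr]

variable [DecidableEq V]

theorem parity_flip_flip {x z : V} (hxz : x ≠ z) (hπ : π x = π z) (f : V → Bool) :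
    parity π (flip z (flip x f)) = parity π f := by
  have key : ∀ (y : V) (f : V → Bool), parity π (flip y f) (π y) = !parity π f (π y) := by
    intro y f
    rw [parity_eq_xor, parity_eq_xor, flip_self, parityOff_congr fun v hv _ => flip_of_ne hv f,
      Bool.not_xor]
  funext i
  by_cases hi : i = π x
  · subst hi
    rw [hπ, key, ← hπ, key, Bool.not_not]
  · refine parity_congr fun v hv => ?_
    rw [flip_of_ne, flip_of_ne]
    · rintro rfl; exact hi hv.symm
    · rintro rfl; exact hi (hv.symm.trans hπ.symm)

/-- The number of assignments with given group parities and given values on the groups in `T`. -/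
noncomputable def fiberSize (π : V → I) (r : I → V) (T : Set I) : ℝ :=
  ∏ v, if v = r (π v) ∨ π v ∈ T then 1 else 2

theorem fiberSize_pos (r : I → V) (T : Set I) : 0 < fiberSize π r T :=
  Finset.prod_pos fun v _ => by split_ifs <;> norm_num

theorem fiberSize_mul (r : I → V) {i j : I} (hij : i ≠ j) (T : Set I) :
    fiberSize π r ({i} ∪ {j} ∪ T) * fiberSize π r T =
      fiberSize π r ({i} ∪ T) * fiberSize π r ({j} ∪ T) := by
  unfold fiberSize
  rw [← Finset.prod_mul_distrib, ← Finset.prod_mul_distrib]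
  refine Finset.prod_congr rfl fun v _ => ?_
  simp only [Set.mem_union, Set.mem_singleton_iff]
  have hnot : ¬(π v = i ∧ π v = j) := fun h => hij (h.1.symm.trans h.2)
  split_ifs <;> first | tauto | norm_num

theorem card_parity_fiber {r : I → V} (hr : ∀ i, π (r i) = i) (T : Set I) (a : V → Bool)
    (g : I → Bool) :
    ((Finset.univ.filter fun f : V → Bool =>
        parity π f = g ∧ ∀ v ∈ π ⁻¹' T, f v = a v).card : ℝ) =
      if ∀ i ∈ T, g i = parity π a i then fiberSize π r T else 0 := by
  split_ifs with h
  · have hcard : (Finset.univ.filter fun f : V → Bool =>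
        parity π f = g ∧ ∀ v ∈ π ⁻¹' T, f v = a v).card =
        (Fintype.piFinset fun v => if v = r (π v) then {g (π v)} else
          if π v ∈ T then {a v} else Finset.univ).card := by
      refine Finset.card_bij' (fun f _ => parityCoord π r f) (fun f _ => parityCoord π r f)
        ?_ ?_ (fun f _ => parityCoord_parityCoord hr f) (fun f _ => parityCoord_parityCoord hr f)
      · intro f hf
        obtain ⟨hg, hf'⟩ := (Finset.mem_filter.1 hf).2
        subst hg
        refine Fintype.mem_piFinset.2 fun v => ?_
        unfold parityCoord
        split_ifs with h1 h2
        · simp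
        · simpa using hf' v h2
        · simp
      · intro f hf
        rw [Fintype.mem_piFinset] at hf
        have hrep : ∀ i, f (r i) = g i := fun i => by simpa [hr] using hf (r i)
        refine Finset.mem_filter.2 ⟨Finset.mem_univ _, funext fun i => ?_, fun v hv => ?_⟩
        · rw [parity_parityCoord hr, hrep]
        · have hloc : ∀ u, π u = π v → f u = parityCoord π r a u := by
            intro u hu
            have huT : π u ∈ T := by rw [hu]; exact hv
            unfold parityCoord
            split_ifs with h1
            · rw [h1, hrep, ← h1]
              exact h _ huT
            · simpa [h1, huT] using hf u
          rw [parityCoord_congr r hloc v rfl, parityCoord_parityCoord hr]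
    rw [hcard, Fintype.card_piFinset, fiberSize, Nat.cast_prod]
    refine Finset.prod_congr rfl fun v _ => ?_
    by_cases h1 : v = r (π v)
    · simp [← h1]
    · by_cases h2 : π v ∈ T <;> simp [h1, h2]
  · rw [Nat.cast_eq_zero, Finset.card_eq_zero, Finset.filter_eq_empty_iff]
    rintro f - ⟨rfl, hf⟩
    exact h fun i hi => parity_congr fun v hv => hf v (by rw [Set.mem_preimage, hv]; exact hi)

theorem margin_insert_add_flip (p : (V → Bool) → ℝ) {x : V} {X : Set V} (hx : x ∉ X)
    (a : V → Bool) :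
    margin (S := fun _ : V => Bool) p (insert x X) a +
        margin (S := fun _ : V => Bool) p (insert x X) (flip x a) =
      margin (S := fun _ : V => Bool) p X a := by
  simp only [margin_eq_sum]
  rw [← Finset.sum_add_distrib]
  refine Finset.sum_congr rfl fun f _ => ?_
  have hX : (∀ v ∈ X, f v = flip x a v) ↔ ∀ v ∈ X, f v = a v :=
    forall₂_congr fun v hv => by rw [flip_of_ne]; rintro rfl; exact hx hv
  simp only [Set.forall_mem_insert, hX, flip_self]
  cases f x <;> cases a x <;> simp

/-- The distribution whose group parities have distribution `q`, and which is uniform given the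
group parities. -/
noncomputable def parityLift (π : V → I) (r : I → V) (q : (I → Bool) → ℝ) (f : V → Bool) : ℝ :=
  (fiberSize π r ∅)⁻¹ * q (parity π f)

/-- Under `parityLift`, a variable is a fair coin given any variables that leave out another
variable of its group. -/
theorem margin_insert_parityLift (r : I → V) (q : (I → Bool) → ℝ) {x z : V} {X : Set V}
    (hx : x ∉ X) (hz : z ∉ X) (hxz : x ≠ z) (h : π x = π z) (a : V → Bool) :
    margin (S := fun _ : V => Bool) (parityLift π r q) (insert x X) a =
      1 / 2 * margin (S := fun _ : V => Bool) (parityLift π r q) X a := by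
  have h1 := margin_insert_add_flip (parityLift π r q) hx a
  have h2 : margin (S := fun _ : V => Bool) (parityLift π r q) (insert x X) (flip x a) =
      margin (S := fun _ : V => Bool) (parityLift π r q) (insert x X) a := by
    rw [margin_eq_sum, margin_eq_sum, ← Equiv.sum_comp ((flip x).trans (flip z))]
    refine Finset.sum_congr rfl fun f _ => ?_
    have hp : parityLift π r q (((flip x).trans (flip z)) f) = parityLift π r q f := by
      rw [parityLift, Equiv.trans_apply, parity_flip_flip hxz h, parityLift]
    have hcond : (∀ v ∈ insert x X, ((flip x).trans (flip z)) f v = flip x a v) ↔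
        ∀ v ∈ insert x X, f v = a v := by
      refine forall₂_congr fun v hv => ?_
      have hvz : v ≠ z := by
        rintro rfl
        rcases hv with hv | hv
        · exact hxz hv.symm
        · exact hz hv
      rw [Equiv.trans_apply, flip_of_ne hvz]
      by_cases hvx : v = x
      · subst hvx
        simp [flip_self]
      · rw [flip_of_ne hvx, flip_of_ne hvx]
    by_cases hc : ∀ v ∈ insert x X, f v = a v
    · rw [if_pos (hcond.2 hc), if_pos hc, hp]
    · rw [if_neg (mt hcond.1 hc), if_neg hc]
  linarith

variable [Fintype I] [DecidableEq I]

theorem margin_parityLift {r : I → V} (hr : ∀ i, π (r i) = i) (q : (I → Bool) → ℝ) (T : Set I)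
    (a : V → Bool) :
    margin (S := fun _ : V => Bool) (parityLift π r q) (π ⁻¹' T) a =
      (fiberSize π r ∅)⁻¹ * fiberSize π r T *
        margin (S := fun _ : I => Bool) q T (parity π a) := by
  rw [margin_eq_sum, margin_eq_sum, ← Finset.sum_fiberwise Finset.univ (parity π), Finset.mul_sum]
  refine Finset.sum_congr rfl fun g _ => ?_
  have h := card_parity_fiber hr T a g
  rw [← Finset.filter_filter] at h
  have : ∀ f ∈ Finset.univ.filter fun f : V → Bool => parity π f = g,
      (if ∀ v ∈ π ⁻¹' T, f v = a v then parityLift π r q f else 0) =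
        if ∀ v ∈ π ⁻¹' T, f v = a v then (fiberSize π r ∅)⁻¹ * q g else 0 := by
    intro f hf
    rw [parityLift, (Finset.mem_filter.1 hf).2]
  rw [Finset.sum_congr rfl this, ← Finset.sum_filter, Finset.sum_const, nsmul_eq_mul]
  refine (congrArg₂ (· * ·) (Eq.trans (by congr!) h) rfl).trans ?_
  split_ifs <;> ring

theorem isDist_parityLift {r : I → V} (hr : ∀ i, π (r i) = i) {q : (I → Bool) → ℝ}
    (hq : IsDist (S := fun _ : I => Bool) q) :
    IsDist (S := fun _ : V => Bool) (parityLift π r q) := by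
  refine ⟨fun f => mul_nonneg (inv_nonneg.2 (fiberSize_pos r _).le) (hq.1 _), ?_⟩
  have := margin_parityLift hr q ∅ fun _ => true
  rw [margin_eq_sum, margin_eq_sum] at this
  simp only [Set.preimage_empty, Set.mem_empty_iff_false, false_imp_iff, implies_true,
    if_true] at this
  rw [this, hq.2, mul_one, inv_mul_cancel₀ (fiberSize_pos r _).ne']

theorem condIndep_parityLift_iff (hπ : Function.Surjective π) {r : I → V}
    (hr : ∀ i, π (r i) = i) (q : (I → Bool) → ℝ) {i j : I} (hij : i ≠ j) (T : Set I) :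
    CondIndep (S := fun _ : V => Bool) (parityLift π r q) (π ⁻¹' {i}) (π ⁻¹' {j}) (π ⁻¹' T) ↔
      CondIndep (S := fun _ : I => Bool) q {i} {j} T := by
  have key : ∀ a : V → Bool,
      (0 < margin (S := fun _ : V => Bool) (parityLift π r q) (π ⁻¹' T) a ↔
        0 < margin (S := fun _ : I => Bool) q T (parity π a)) ∧
      (margin (S := fun _ : V => Bool) (parityLift π r q)
            (π ⁻¹' {i} ∪ π ⁻¹' {j} ∪ π ⁻¹' T) a *
          margin (S := fun _ : V => Bool) (parityLift π r q) (π ⁻¹' T) a =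
        margin (S := fun _ : V => Bool) (parityLift π r q) (π ⁻¹' {i} ∪ π ⁻¹' T) a *
          margin (S := fun _ : V => Bool) (parityLift π r q) (π ⁻¹' {j} ∪ π ⁻¹' T) a ↔
      margin (S := fun _ : I => Bool) q ({i} ∪ {j} ∪ T) (parity π a) *
          margin (S := fun _ : I => Bool) q T (parity π a) =
        margin (S := fun _ : I => Bool) q ({i} ∪ T) (parity π a) *
          margin (S := fun _ : I => Bool) q ({j} ∪ T) (parity π a)) := by
    intro a
    have h0 := fiberSize_pos (π := π) r ∅
    have hT := fiberSize_pos (π := π) r T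
    have hiT := fiberSize_pos (π := π) r ({i} ∪ T)
    have hjT := fiberSize_pos (π := π) r ({j} ∪ T)
    simp only [← Set.preimage_union, margin_parityLift hr]
    refine ⟨mul_pos_iff_of_pos_left (by positivity), ?_⟩
    have hc : (fiberSize π r ∅)⁻¹ * (fiberSize π r ∅)⁻¹ *
        (fiberSize π r ({i} ∪ T) * fiberSize π r ({j} ∪ T)) ≠ 0 := by positivity
    refine Iff.trans ?_ (mul_right_inj' hc)
    refine iff_of_eq (congrArg₂ (· = ·) ?_ (by ring))
    rw [← fiberSize_mul r hij]
    ring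
  constructor
  · intro h b hb
    obtain ⟨a, rfl⟩ := exists_parity_eq hπ b
    exact (key a).2.1 (h a ((key a).1.2 hb))
  · intro h a ha
    exact (key a).2.2 (h _ ((key a).1.1 ha))

theorem not_faithful_parityLift (hπ : Function.Surjective π) {r : I → V}
    (hr : ∀ i, π (r i) = i) {q : (I → Bool) → ℝ} (hq : IsDist (S := fun _ : I => Bool) q) {i : I}
    (hi : 3 ≤ (π ⁻¹' {i}).ncard)
    (hcoin : margin (S := fun _ : I => Bool) q {i} (fun _ => true) ≠ 1 / 2)
    (G : V → V → Prop) : ¬ Faithful (S := fun _ : V => Bool) (parityLift π r q) G := by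
  intro hG
  have hp := isDist_parityLift hr hq
  have hempty : ∀ a, margin (S := fun _ : V => Bool) (parityLift π r q) ∅ a = 1 := by
    intro a
    rw [margin_eq_sum]
    simpa using hp.2
  have hthird : ∀ x y : V, ∃ z, π z = i ∧ z ≠ x ∧ z ≠ y := by
    intro x y
    have h2 : ({x, y} : Set V).ncard < (π ⁻¹' {i}).ncard := by
      have := Set.ncard_insert_le x {y}
      rw [Set.ncard_singleton] at this
      omega
    obtain ⟨z, hz, hz'⟩ := Set.exists_mem_notMem_of_ncard_lt_ncard h2
    simp only [Set.mem_insert_iff, Set.mem_singleton_iff, not_or] at hz'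
    exact ⟨z, hz, hz'⟩
  obtain ⟨x, hx, -⟩ := hthird (r i) (r i)
  obtain ⟨y₀, hy₀, hy₀x, -⟩ := hthird x x
  have hsingle : ∀ a, margin (S := fun _ : V => Bool) (parityLift π r q) {x} a = 1 / 2 := by
    intro a
    rw [← insert_empty_eq, margin_insert_parityLift r q (z := y₀) (by simp) (by simp) hy₀x.symm
      (hx.trans hy₀.symm), hempty, mul_one]
  have hpair : ∀ y, π y = i → y ≠ x → DSep G ∅ x y := by
    intro y hy hyx
    refine (hG {x} {y} ∅ (by simp) (by simp) (by simpa using hyx.symm) (by simp) (by simp)).1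
      (fun a _ => ?_) x rfl y rfl
    obtain ⟨z, hz, hzx, hzy⟩ := hthird x y
    rw [Set.union_empty, Set.union_empty, Set.union_empty, hempty, hsingle, mul_one,
      Set.singleton_union]
    exact margin_insert_parityLift r q (by simpa using hyx.symm) (by simpa using hzy) hzx.symm
      (hx.trans hz.symm) a
  set Y : Set V := π ⁻¹' {i} \ {x} with hY
  have hins : insert x Y = π ⁻¹' {i} := Set.insert_sdiff_self_of_mem hx
  have hxY : x ∉ Y := fun h => h.2 rfl
  have hci := (hG {x} Y ∅ (by simp) ⟨y₀, hy₀, hy₀x⟩ (by simpa using hxY) (by simp) (by simp)).2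
    (by rintro _ rfl y ⟨hy, hyx⟩; exact hpair y hy hyx)
  obtain ⟨a, ha⟩ := exists_parity_eq hπ fun _ => true
  have h := hci.eq hp.1 a
  rw [Set.union_empty, Set.union_empty, Set.union_empty, hempty, hsingle, mul_one,
    Set.singleton_union, ← margin_insert_add_flip _ hxY, hins, margin_parityLift hr,
    margin_parityLift hr, ha] at h
  have hflip : margin (S := fun _ : I => Bool) q {i} (fun _ => true) +
      margin (S := fun _ : I => Bool) q {i} (parity π (flip x a)) = 1 := by
    have hval : parity π (flip x a) i = flip i (fun _ => true) i := by
      subst hx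
      have h1 := parity_eq_xor (π := π) x a
      rw [ha] at h1
      rw [parity_eq_xor, flip_self, flip_self,
        parityOff_congr fun v hv _ => flip_of_ne hv a, Bool.not_xor, ← h1]
    have hq1 := margin_insert_add_flip q (x := i) (X := ∅) (by simp) fun _ => true
    rw [insert_empty_eq] at hq1
    have e1 : margin (S := fun _ : I => Bool) q {i} (parity π (flip x a)) =
        margin (S := fun _ : I => Bool) q {i} (flip i fun _ => true) := by
      simp only [margin_eq_sum, Set.mem_singleton_iff, forall_eq, hval]
    have e2 : margin (S := fun _ : I => Bool) q ∅ (fun _ => true) = 1 := by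
      rw [margin_eq_sum]
      simpa using hq.2
    rw [e1, hq1, e2]
  refine hcoin ?_
  have hc : (fiberSize π r ∅)⁻¹ * fiberSize π r {i} ≠ 0 :=
    (mul_pos (inv_pos.2 (fiberSize_pos r _)) (fiberSize_pos r _)).ne'
  rw [← mul_add, hflip, mul_one, mul_comm (1 / 2 : ℝ)] at h
  exact mul_left_cancel₀ hc h

end Parity

/-- Lemma 12 of the paper. If some group has size at least 3,
then there is a binary-valued distribution that is groupwise faithful to the group
DAG `H` given the grouping but is not faithful to any DAG on the variables. -/
theorem size_three_groupwise_faithful_unfaithful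
    {V I : Type*} [Fintype V] [Fintype I] [DecidableEq V]
    (π : V → I) (hπ : Function.Surjective π)
    (H : I → I → Prop) (hH : IsDAG H)
    (hbig : ∃ i : I, 3 ≤ (π ⁻¹' {i}).ncard) :
    ∃ p : (∀ _ : V, Bool) → ℝ, IsDist p ∧ GroupwiseFaithful p π H ∧
      ∀ G : V → V → Prop, IsDAG G → ¬ Faithful p G := by
  obtain ⟨i, hi⟩ := hbig
  obtain ⟨r, hr⟩ := hπ.hasRightInverse
  obtain ⟨θ, hθ, hfaith, hcoin⟩ := exists_faithful_kernel hH i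
  have hq := hθ.isDist_joint hH
  exact ⟨parityLift π r (joint θ), isDist_parityLift hr hq,
    fun i j hij T hiT hjT =>
      (condIndep_parityLift_iff hπ hr _ hij T).trans (hfaith i j hij T hiT hjT),
    fun G _ => not_faithful_parityLift hπ hr hq hi hcoin G⟩

end GroupBN
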